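/- arXiv:2103.03570 — 2 statements merged into one kernel-verified Lean document; each statement's English description precedes it below -/
import Mathlib

section
/- Let (u_k)_{k∈ℕ} and (v_k)_{k∈ℕ} be two non-negative real sequences. Assume that ∑_{k=0}^∞ u_k v_k < +∞ and ∑_{k=0}^∞ v_k = +∞. If there exists a constant C > 0 such that for all k ∈ ℕ, |u_{k+1} − u_k| ≤ C v_k, then u_k → 0 as k → ∞. -/
open Filter

/-- Lemma (Alber et al., Proposition 2): if `(u k)` and `(v k)` are non-negative sequences with
`∑ u k * v k < ∞`, `∑ v k = ∞`, and `|u (k+1) - u k| ≤ C * v k` for some `C > 0`,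
then `u k → 0`. -/
theorem alber_sequence_lemma (u v : ℕ → ℝ)
    (hu : ∀ k, 0 ≤ u k) (hv : ∀ k, 0 ≤ v k)
    (hsum : Summable (fun k => u k * v k))
    (hdiv : ¬ Summable v)
    (C : ℝ) (hC : 0 < C)
    (hvar : ∀ k, |u (k + 1) - u k| ≤ C * v k) :
    Tendsto u atTop (nhds 0) := by
  set S : ℕ → ℝ := fun n => ∑ k ∈ Finset.range n, u k * v k
  have hStend : Tendsto S atTop (nhds (∑' k, u k * v k)) := hsum.hasSum.tendsto_sum_nat
  have hSle : ∀ n, S n ≤ ∑' k, u k * v k := fun n =>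
    hsum.sum_le_tsum _ fun k _ => mul_nonneg (hu k) (hv k)
  have hmono : Monotone fun n => u n ^ 2 + 2 * C * S n := by
    refine monotone_nat_of_le_succ fun n => ?_
    have hsucc : S (n + 1) = S n + u n * v n := Finset.sum_range_succ _ _
    have hstep : u n - u (n + 1) ≤ C * v n := by linarith [neg_abs_le (u (n + 1) - u n), hvar n]
    simp only [hsucc]
    nlinarith [mul_le_mul_of_nonneg_left hstep (hu n), sq_nonneg (u n - u (n + 1))]
  have hsmall : ∀ ε > 0, ∀ m, ∃ n ≥ m, u n < ε := by
    intro ε hε m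
    by_contra! hlarge
    refine hdiv ((summable_nat_add_iff m).1 (Summable.of_nonneg_of_le (fun k => hv (k + m))
      (fun k => ?_) (((summable_nat_add_iff m).2 hsum).mul_left ε⁻¹)))
    rw [inv_mul_eq_div, le_div_iff₀ hε, mul_comm]
    exact mul_le_mul_of_nonneg_right (hlarge _ (Nat.le_add_left m k)) (hv _)
  have hbound : ∀ m, u m ^ 2 ≤ 2 * C * (∑' k, u k * v k - S m) := by
    intro m
    refine le_of_forall_pos_le_add fun ε hε => ?_
    obtain ⟨n, hmn, hn⟩ := hsmall (√ε) (Real.sqrt_pos.2 hε) m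
    have hsq : u n ^ 2 ≤ ε := (Real.le_sqrt (hu n) hε.le).1 hn.le
    have hle := hmono hmn
    simp only at hle
    nlinarith [mul_le_mul_of_nonneg_left (hSle n) hC.le]
  have hsqtend : Tendsto (fun m => u m ^ 2) atTop (nhds 0) := by
    refine squeeze_zero (fun m => sq_nonneg _) hbound ?_
    simpa using (hStend.const_sub (∑' k, u k * v k)).const_mul (2 * C)
  simpa [Real.sqrt_sq (hu _)] using hsqtend.sqrt
end

section
/- Let δ ∈ (0, 1/2), A > 0, B ≥ 0, and let (x_k)_{k∈ℕ} be a real sequence bounded below and (e_k)_{k∈ℕ} a non-negative real sequence such that for all k ∈ ℕ, x_{k+1} ≤ x_k − A (k+1)^{−(1/2+δ)} e_k + B (k+1)^{−(1+2δ)}. Then there exists a constant C₄ > 0 such that for all K ∈ ℕ_{>0}, min_{j∈{0,…,K−1}} e_j ≤ C₄ / K^{1/2−δ}. -/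
/-- Summing a descent recursion `x (k+1) ≤ x k - a k + b k`. -/
lemma sum_range_le_of_descent {x a b : ℕ → ℝ} (h : ∀ k, x (k + 1) ≤ x k - a k + b k) (n : ℕ) :
    ∑ k ∈ Finset.range n, a k ≤ x 0 - x n + ∑ k ∈ Finset.range n, b k := by
  rw [← Finset.sum_range_sub', ← Finset.sum_add_distrib]
  exact Finset.sum_le_sum fun k _ => by linarith [h k]

lemma summable_nat_add_one_rpow_neg {p : ℝ} (hp : 1 < p) :
    Summable fun k : ℕ => ((k : ℝ) + 1) ^ (-p) := by
  simpa using (summable_nat_add_iff 1).2 (Real.summable_nat_rpow.2 (neg_lt_neg hp))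

/-- For `p ≥ 0`, the first `n` weights `(k+1)^{-p}` have sum at least `n^{1-p}`. -/
lemma rpow_one_sub_le_sum_range {p : ℝ} (hp : 0 ≤ p) {n : ℕ} (hn : 0 < n) :
    (n : ℝ) ^ (1 - p) ≤ ∑ k ∈ Finset.range n, ((k : ℝ) + 1) ^ (-p) := by
  have hn' : (0 : ℝ) < n := Nat.cast_pos.2 hn
  calc (n : ℝ) ^ (1 - p) = ∑ _k ∈ Finset.range n, (n : ℝ) ^ (-p) := by
        rw [Finset.sum_const, Finset.card_range, nsmul_eq_mul, sub_eq_add_neg,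
          Real.rpow_add hn', Real.rpow_one]
    _ ≤ _ := Finset.sum_le_sum fun k hk =>
        Real.rpow_le_rpow_of_nonpos (by positivity)
          (by exact_mod_cast Finset.mem_range.1 hk) (neg_nonpos.2 hp)

/-- Rate lemma: if `(x k)` is bounded below, `(e k)` is non-negative and
`x (k+1) ≤ x k − A (k+1)^{-(1/2+δ)} e k + B (k+1)^{-(1+2δ)}` with `A > 0`, `B ≥ 0`,
`δ ∈ (0, 1/2)`, then `min_{j < K} e j = O(1 / K^{1/2−δ})`. -/
theorem rate_from_descent_recursion (δ A B : ℝ)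
    (hδ : δ ∈ Set.Ioo (0 : ℝ) (1 / 2)) (hA : 0 < A) (hB : 0 ≤ B)
    (x e : ℕ → ℝ)
    (hx : ∃ c : ℝ, ∀ k, c ≤ x k)
    (he : ∀ k, 0 ≤ e k)
    (hrec : ∀ k : ℕ, x (k + 1) ≤ x k - A * ((k : ℝ) + 1) ^ (-(1 / 2 + δ)) * e k
        + B * ((k : ℝ) + 1) ^ (-(1 + 2 * δ))) :
    ∃ C₄ > (0 : ℝ), ∀ K : ℕ, 0 < K → ∃ j < K, e j ≤ C₄ / (K : ℝ) ^ (1 / 2 - δ) := by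
  obtain ⟨c, hc⟩ := hx
  obtain ⟨hδ0, -⟩ := hδ
  have hsum := summable_nat_add_one_rpow_neg (p := 1 + 2 * δ) (by linarith)
  set S := ∑' k : ℕ, ((k : ℝ) + 1) ^ (-(1 + 2 * δ))
  have hS : 0 ≤ S := tsum_nonneg fun k => by positivity
  have hx0 := hc 0
  have hBS := mul_nonneg hB hS
  refine ⟨(x 0 - c + B * S + 1) / A, div_pos (by linarith) hA, fun K hK => ?_⟩
  obtain ⟨j, hj, hmin⟩ := Finset.exists_min_image (Finset.range K) e ⟨0, Finset.mem_range.2 hK⟩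
  refine ⟨j, Finset.mem_range.1 hj, ?_⟩
  have hKpos : (0 : ℝ) < (K : ℝ) ^ (1 / 2 - δ) := Real.rpow_pos_of_pos (Nat.cast_pos.2 hK) _
  have hweights := rpow_one_sub_le_sum_range (p := 1 / 2 + δ) (by linarith) hK
  rw [show 1 - (1 / 2 + δ) = 1 / 2 - δ by ring] at hweights
  rw [le_div_iff₀ hKpos, le_div_iff₀ hA]
  calc e j * (K : ℝ) ^ (1 / 2 - δ) * A
      ≤ e j * (∑ k ∈ Finset.range K, ((k : ℝ) + 1) ^ (-(1 / 2 + δ))) * A := by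
        have := he j
        gcongr
    _ = ∑ k ∈ Finset.range K, A * ((k : ℝ) + 1) ^ (-(1 / 2 + δ)) * e j := by
        rw [← Finset.sum_mul, ← Finset.mul_sum]; ring
    _ ≤ ∑ k ∈ Finset.range K, A * ((k : ℝ) + 1) ^ (-(1 / 2 + δ)) * e k :=
        Finset.sum_le_sum fun k hk => mul_le_mul_of_nonneg_left (hmin k hk) (by positivity)
    _ ≤ x 0 - x K + ∑ k ∈ Finset.range K, B * ((k : ℝ) + 1) ^ (-(1 + 2 * δ)) :=
        sum_range_le_of_descent hrec K
    _ ≤ x 0 - c + B * S := by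
        rw [← Finset.mul_sum]
        gcongr
        · exact hc K
        · exact hsum.sum_le_tsum _ fun k _ => by positivity
    _ ≤ x 0 - c + B * S + 1 := by linarith
end
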